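/- Let λ ∈ ℝ and let u, w : ℝ × ℝ → ℝ be smooth functions such that u solves the potential KdV equation ∂_t u = 3(∂_x u)² + ∂_x³ u and the pair (u, w) satisfies the Bäcklund covering equations ∂_x w = λ − ∂_x u − (1/2)(w − u)² and ∂_t w = 2λ² − 2λ ∂_x u − (∂_x u)² − ∂_x³ u + 2(∂_x² u)(w − u) − (λ + ∂_x u)(w − u)² at every point. Then w also solves the potential KdV equation: ∂_t w = 3(∂_x w)² + ∂_x³ w at every point of ℝ². -/

import Mathlib

open Real

/-- Partial derivative in the first coordinate. -/
noncomputable def pdx (f : ℝ × ℝ → ℝ) (p : ℝ × ℝ) : ℝ := fderiv ℝ f p (1, 0)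

/-- Partial derivative in the second coordinate. -/
noncomputable def pdy (f : ℝ × ℝ → ℝ) (p : ℝ × ℝ) : ℝ := fderiv ℝ f p (0, 1)

theorem ContDiff.pdx {f : ℝ × ℝ → ℝ} (hf : ContDiff ℝ (⊤ : ℕ∞) f) :
    ContDiff ℝ (⊤ : ℕ∞) (pdx f) :=
  (hf.fderiv_right (m := (⊤ : ℕ∞)) (by simp)).clm_apply contDiff_const

theorem pdx_sub {f g : ℝ × ℝ → ℝ} (hf : Differentiable ℝ f) (hg : Differentiable ℝ g)
    (p : ℝ × ℝ) : pdx (fun q => f q - g q) p = pdx f p - pdx g p := by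
  simp [pdx, fderiv_fun_sub (hf p) (hg p)]

theorem pdx_mul {f g : ℝ × ℝ → ℝ} (hf : Differentiable ℝ f) (hg : Differentiable ℝ g)
    (p : ℝ × ℝ) : pdx (fun q => f q * g q) p = f p * pdx g p + g p * pdx f p := by
  simp [pdx, fderiv_fun_mul (hf p) (hg p)]

theorem pdx_const (c : ℝ) (p : ℝ × ℝ) : pdx (fun _ => c) p = 0 := by
  simp [pdx]

/-- The second `x`-derivative of a solution of the Riccati equation in the Bäcklund covering. -/
theorem pdx_pdx_of_riccati {lam : ℝ} {u w : ℝ × ℝ → ℝ} (hu : Differentiable ℝ u)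
    (hux : Differentiable ℝ (pdx u)) (hw : Differentiable ℝ w)
    (h : ∀ p, pdx w p = lam - pdx u p - (1 / 2) * (w p - u p) ^ 2) (p : ℝ × ℝ) :
    pdx (pdx w) p = 0 - pdx (pdx u) p - (w p - u p) * (pdx w p - pdx u p) := by
  have hv : Differentiable ℝ (fun q => w q - u q) := hw.sub hu
  have hfun : pdx w =
      fun q => lam - pdx u q - (1 / 2) * ((w q - u q) * (w q - u q)) := by
    funext q
    rw [h q, sq]
  conv_lhs => rw [hfun]
  rw [pdx_sub (by fun_prop) (by fun_prop), pdx_sub (by fun_prop) hux,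
    pdx_mul (by fun_prop) (by fun_prop), pdx_mul hv hv, pdx_sub hw hu]
  simp only [pdx_const]
  ring

/-- If `u` solves potential KdV and `(u, w)` satisfies the Bäcklund covering
equations, then `w` also solves potential KdV. -/
theorem pkdv_backlund_transform
    (lam : ℝ) (u w : ℝ × ℝ → ℝ) (hu : ContDiff ℝ (⊤ : ℕ∞) u) (hw : ContDiff ℝ (⊤ : ℕ∞) w)
    (hpkdv : ∀ p : ℝ × ℝ, pdy u p = 3 * (pdx u p) ^ 2 + pdx (pdx (pdx u)) p)
    (hc1 : ∀ p : ℝ × ℝ,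
      pdx w p = lam - pdx u p - (1 / 2) * (w p - u p) ^ 2)
    (hc2 : ∀ p : ℝ × ℝ,
      pdy w p = 2 * lam ^ 2 - 2 * lam * pdx u p - (pdx u p) ^ 2
        - pdx (pdx (pdx u)) p + 2 * pdx (pdx u) p * (w p - u p)
        - (lam + pdx u p) * (w p - u p) ^ 2) :
    ∀ p : ℝ × ℝ, pdy w p = 3 * (pdx w p) ^ 2 + pdx (pdx (pdx w)) p := by
  intro p
  have du : Differentiable ℝ u := hu.differentiable (by simp)
  have dux : Differentiable ℝ (pdx u) := hu.pdx.differentiable (by simp)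
  have duxx : Differentiable ℝ (pdx (pdx u)) := hu.pdx.pdx.differentiable (by simp)
  have dw : Differentiable ℝ w := hw.differentiable (by simp)
  have dwx : Differentiable ℝ (pdx w) := hw.pdx.differentiable (by simp)
  have hwxx := pdx_pdx_of_riccati du dux dw hc1
  have hwxxx : pdx (pdx (pdx w)) p = - pdx (pdx (pdx u)) p
      - (pdx w p - pdx u p) ^ 2 - (w p - u p) * (pdx (pdx w) p - pdx (pdx u) p) := by
    conv_lhs => rw [funext hwxx]
    rw [pdx_sub (by fun_prop) (by fun_prop), pdx_sub (by fun_prop) duxx,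
      pdx_mul (by fun_prop) (by fun_prop), pdx_sub dw du, pdx_sub dwx dux, pdx_const]
    ring
  rw [hwxxx, hwxx, hc1, hc2]
  ring
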